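/- Let $m\ge 1$ and $n\ge 1$ be rational integers of the same parity with $(m,n)\ne(1,1)$, and let $f>2$. Then $$\frac{2}{\phi(f)}\sum_{\chi\bmod f,\ \chi(-1)=(-1)^m}L(m,\chi)\overline{L(n,\chi)}=\zeta(m+n)\Biggl(\phi_{m+n}(f)+(-1)^{m-1}\binom{m+n}{m}\sum_{k=1}^{\lfloor m/2\rfloor}\frac{n}{m+n-2k}\binom{m}{2k}\frac{B_{2k}B_{m+n-2k}}{B_{m+n}}\frac{\phi_{2k}(f)}{f^{m+n-2k}}+(-1)^{n-1}\binom{m+n}{n}\sum_{k=1}^{\lfloor n/2\rfloor}\frac{m}{m+n-2k}\binom{n}{2k}\frac{B_{2k}B_{m+n-2k}}{B_{m+n}}\frac{\phi_{2k}(f)}{f^{m+n-2k}}\Biggr),$$ the sum being over the $\phi(f)/2$ Dirichlet characters modulo $f$ with $\chi(-1)=(-1)^m=(-1)^n$. -/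

import Mathlib

open scoped Classical Real

open Finset in
lemma bernoulliFun_eq_sum (n : ℕ) (x : ℝ) :
    bernoulliFun n x =
      ∑ j ∈ range (n + 1), (n.choose j : ℝ) * (bernoulli j : ℝ) * x ^ (n - j) := by
  simp only [bernoulliFun, Polynomial.bernoulli, Polynomial.map_sum, Polynomial.map_monomial,
    Polynomial.eval_finsetSum, Polynomial.eval_monomial]
  refine sum_congr rfl fun j _ => ?_
  simp only [eq_ratCast, Rat.cast_mul, Rat.cast_natCast]
  ring

lemma bernoulliFun_add_one (n : ℕ) (x : ℝ) :
    bernoulliFun n (x + 1) = bernoulliFun n x + n * x ^ (n - 1) := by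
  have h := congrArg (fun p : Polynomial ℚ => (p.map (algebraMap ℚ ℝ)).eval x)
    (Polynomial.bernoulli_comp_one_add_X n)
  simpa [bernoulliFun, Polynomial.map_comp, add_comm] using h

open Finset in
/-- The only nonzero Bernoulli number of odd index is `bernoulli 1 = -1 / 2`. -/
lemma sum_choose_mul_bernoulli_eq {m : ℕ} (hm : 1 ≤ m) (F : ℕ → ℝ) :
    ∑ j ∈ range (m + 1), (m.choose j : ℝ) * (bernoulli j : ℝ) * F j =
      ∑ k ∈ range (m / 2 + 1), (m.choose (2 * k) : ℝ) * (bernoulli (2 * k) : ℝ) * F (2 * k)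
        - m / 2 * F 1 := by
  rw [← sum_filter_add_sum_filter_not (range (m + 1)) Even, sub_eq_add_neg]
  congr 1
  · refine (sum_bij (fun k _ => 2 * k) ?_ ?_ ?_ ?_).symm
    · intro k hk
      simp only [mem_range, mem_filter] at hk ⊢
      exact ⟨by omega, even_two_mul k⟩
    · intro a _ b _ h
      exact Nat.eq_of_mul_eq_mul_left two_pos h
    · intro b hb
      simp only [mem_range, mem_filter] at hb
      obtain ⟨k, hk⟩ := hb.2
      exact ⟨k, by simp only [mem_range]; omega, by omega⟩
    · intro a _
      rfl
  · rw [sum_eq_single_of_mem 1]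
    · simp [bernoulli_one]
      ring
    · simp; omega
    · intro j hj hj1
      simp only [mem_range, mem_filter, Nat.not_even_iff_odd] at hj
      rw [bernoulli_eq_zero_of_odd hj.2 (by have := hj.2.pos; omega)]
      simp

lemma Polynomial.eq_C_of_eval_add_one {R : Type*} [CommRing R] [IsDomain R] [CharZero R]
    (p : Polynomial R) (h : ∀ x, p.eval (x + 1) = p.eval x) : p = C (p.eval 0) := by
  refine Polynomial.eq_of_infinite_eval_eq _ _ (Set.infinite_of_injective_forall_mem
    (f := ((↑) : ℕ → R)) Nat.cast_injective fun n => ?_)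
  simp only [Set.mem_ofPred_eq, eval_C]
  induction n with
  | zero => simp
  | succ k ih => rw [Nat.cast_succ, h, ih]

lemma integral_bernoulliFun_mul_bernoulliFun {m n : ℕ} (hm : 1 ≤ m) (hn : 1 ≤ n) :
    ∫ x in (0 : ℝ)..1, bernoulliFun m x * bernoulliFun n x =
      (-1) ^ (m + 1) * (m.factorial * n.factorial / (m + n).factorial) * bernoulli (m + n) := by
  induction m, hm using Nat.le_induction generalizing n with
  | base =>
    have key := intervalIntegral.integral_mul_deriv_eq_deriv_mul (a := 0) (b := 1)
      (u := bernoulliFun 1) (v := fun x => bernoulliFun (n + 1) x / (n + 1))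
      (u' := fun x => (1 : ℕ) * bernoulliFun 0 x) (v' := bernoulliFun n)
      (fun x _ => hasDerivAt_bernoulliFun 1 x) (fun x _ => antideriv_bernoulliFun n x)
      (by simp) (intervalIntegrable_bernoulliFun _ _ _)
    rw [key]
    have h1 : bernoulliFun (n + 1) 1 = bernoulliFun (n + 1) 0 :=
      bernoulliFun_endpoints_eq_of_ne_one (by omega)
    have h0 : ∫ x in (0:ℝ)..1, bernoulliFun (n + 1) x = 0 :=
      integral_bernoulliFun_eq_zero (by omega)
    simp only [bernoulliFun_zero, intervalIntegral.integral_div, one_mul, Nat.cast_one, h0, h1,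
      bernoulliFun_one, bernoulliFun_eval_zero]
    rw [add_comm 1 n, Nat.factorial_succ n, Nat.factorial_one]
    have := n.factorial_ne_zero
    push_cast
    field_simp
    simp only [bernoulli_one]
    push_cast
    ring
  | succ m hm ih =>
    have key := intervalIntegral.integral_mul_deriv_eq_deriv_mul (a := 0) (b := 1)
      (u := bernoulliFun (m + 1)) (v := fun x => bernoulliFun (n + 1) x / (n + 1))
      (u' := fun x => (m + 1 : ℕ) * bernoulliFun m x) (v' := bernoulliFun n)
      (fun x _ => hasDerivAt_bernoulliFun (m + 1) x) (fun x _ => antideriv_bernoulliFun n x)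
      ((intervalIntegrable_bernoulliFun _ _ _).const_mul _) (intervalIntegrable_bernoulliFun _ _ _)
    rw [key]
    have h1 : bernoulliFun (n + 1) 1 = bernoulliFun (n + 1) 0 :=
      bernoulliFun_endpoints_eq_of_ne_one (by omega)
    have h2 : bernoulliFun (m + 1) 1 = bernoulliFun (m + 1) 0 :=
      bernoulliFun_endpoints_eq_of_ne_one (by omega)
    have h3 : ∀ x, ((m + 1 : ℕ) : ℝ) * bernoulliFun m x * (bernoulliFun (n + 1) x / (n + 1)) =
        ((m + 1 : ℕ) : ℝ) / (n + 1) * (bernoulliFun m x * bernoulliFun (n + 1) x) := by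
      intro x; ring
    simp only [h3, intervalIntegral.integral_const_mul]
    rw [ih (by omega), h1, h2, show m + (n + 1) = m + 1 + n by ring, Nat.factorial_succ m,
      Nat.factorial_succ n]
    have := (m + 1 + n).factorial_ne_zero
    push_cast
    field_simp
    ring

open Finset in
lemma bernoulliFun_mul_bernoulliFun {m n : ℕ} (hm : 1 ≤ m) (hn : 1 ≤ n) (x : ℝ) :
    bernoulliFun m x * bernoulliFun n x =
      ∑ k ∈ range (m / 2 + 1), (m.choose (2 * k) : ℝ) * (bernoulli (2 * k) : ℝ) *
        (n / ((m + n - 2 * k : ℕ) : ℝ) * bernoulliFun (m + n - 2 * k) x) +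
      ∑ k ∈ range (n / 2 + 1), (n.choose (2 * k) : ℝ) * (bernoulli (2 * k) : ℝ) *
        (m / ((m + n - 2 * k : ℕ) : ℝ) * bernoulliFun (m + n - 2 * k) x) +
      (-1) ^ (m + 1) * (m.factorial * n.factorial / (m + n).factorial) * bernoulli (m + n) := by
  let P (k : ℕ) : Polynomial ℝ := (Polynomial.bernoulli k).map (algebraMap ℚ ℝ)
  have hP (k x) : (P k).eval x = bernoulliFun k x := rfl
  let D : Polynomial ℝ := P m * P n -
    ∑ k ∈ range (m / 2 + 1), Polynomial.C ((m.choose (2 * k) : ℝ) * (bernoulli (2 * k) : ℝ) *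
        (n / ((m + n - 2 * k : ℕ) : ℝ))) * P (m + n - 2 * k) -
    ∑ k ∈ range (n / 2 + 1), Polynomial.C ((n.choose (2 * k) : ℝ) * (bernoulli (2 * k) : ℝ) *
        (m / ((m + n - 2 * k : ℕ) : ℝ))) * P (m + n - 2 * k)
  have hD (x : ℝ) : D.eval x = bernoulliFun m x * bernoulliFun n x -
      ∑ k ∈ range (m / 2 + 1), ((m.choose (2 * k) : ℝ) * (bernoulli (2 * k) : ℝ) *
        (n / ((m + n - 2 * k : ℕ) : ℝ))) * bernoulliFun (m + n - 2 * k) x -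
      ∑ k ∈ range (n / 2 + 1), ((n.choose (2 * k) : ℝ) * (bernoulli (2 * k) : ℝ) *
        (m / ((m + n - 2 * k : ℕ) : ℝ))) * bernoulliFun (m + n - 2 * k) x := by
    simp only [D, Polynomial.eval_sub, Polynomial.eval_mul, Polynomial.eval_finsetSum,
      Polynomial.eval_C, hP]
  have expand {a b : ℕ} (ha : 1 ≤ a) (hb : 1 ≤ b) (y : ℝ) :
      b * y ^ (b - 1) * bernoulliFun a y =
        ∑ k ∈ range (a / 2 + 1), (a.choose (2 * k) : ℝ) * (bernoulli (2 * k) : ℝ) *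
          (b * y ^ (a + b - 2 * k - 1)) - a / 2 * (b * y ^ (a + b - 1 - 1)) := by
    rw [← sum_choose_mul_bernoulli_eq ha (fun j => b * y ^ (a + b - j - 1)), bernoulliFun_eq_sum,
      mul_sum]
    refine sum_congr rfl fun j hj => ?_
    rw [mem_range] at hj
    rw [show a + b - j - 1 = (b - 1) + (a - j) by omega, pow_add]
    ring
  have diff {a b : ℕ} (hb : 1 ≤ b) (y : ℝ) :
      ∑ k ∈ range (a / 2 + 1), ((a.choose (2 * k) : ℝ) * (bernoulli (2 * k) : ℝ) *
        (b / ((a + b - 2 * k : ℕ) : ℝ))) * bernoulliFun (a + b - 2 * k) (y + 1) =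
      ∑ k ∈ range (a / 2 + 1), ((a.choose (2 * k) : ℝ) * (bernoulli (2 * k) : ℝ) *
        (b / ((a + b - 2 * k : ℕ) : ℝ))) * bernoulliFun (a + b - 2 * k) y +
      ∑ k ∈ range (a / 2 + 1), (a.choose (2 * k) : ℝ) * (bernoulli (2 * k) : ℝ) *
          (b * y ^ (a + b - 2 * k - 1)) := by
    rw [← sum_add_distrib]
    refine sum_congr rfl fun k hk => ?_
    rw [mem_range] at hk
    have : ((a + b - 2 * k : ℕ) : ℝ) ≠ 0 := Nat.cast_ne_zero.mpr (by omega)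
    rw [bernoulliFun_add_one]
    field_simp
  have hper (y : ℝ) : D.eval (y + 1) = D.eval y := by
    have e1 := expand hm hn y
    have e2 := expand hn hm y
    have d1 := diff (a := m) hn y
    have d2 := diff (a := n) hm y
    have hpow : (y ^ (m - 1)) * y ^ (n - 1) = y ^ (m + n - 1 - 1) := by
      rw [← pow_add]; congr 1; omega
    simp only [add_comm n m] at e2 d2
    rw [hD, hD, d1, d2, bernoulliFun_add_one, bernoulliFun_add_one]
    linear_combination e1 + e2 + (m : ℝ) * n * hpow
  have hC : ∀ x, D.eval x = D.eval 0 := fun x => by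
    conv_lhs => rw [D.eq_C_of_eval_add_one hper, Polynomial.eval_C]
  have hint : ∫ y in (0 : ℝ)..1, D.eval y = D.eval 0 := by
    simp only [hC, intervalIntegral.integral_const]; simp
  have hz (a b c : ℕ) (hab : 2 * (c / 2) < a + b) (F : ℕ → ℝ) :
      ∫ y in (0 : ℝ)..1, ∑ k ∈ range (c / 2 + 1), F k * bernoulliFun (a + b - 2 * k) y = 0 := by
    rw [intervalIntegral.integral_finsetSum
      fun k _ => (intervalIntegrable_bernoulliFun _ _ _).const_mul _]
    refine sum_eq_zero fun k hk => ?_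
    rw [mem_range] at hk
    rw [intervalIntegral.integral_const_mul, integral_bernoulliFun_eq_zero (by omega), mul_zero]
  have hcont (c : ℕ → ℝ) (e : ℕ → ℕ) (s : Finset ℕ) :
      Continuous fun y => ∑ k ∈ s, c k * bernoulliFun (e k) y :=
    continuous_finsetSum _ fun k _ => continuous_const.mul (continuous_bernoulliFun _)
  have hmul : Continuous fun y => bernoulliFun m y * bernoulliFun n y :=
    (continuous_bernoulliFun m).mul (continuous_bernoulliFun n)
  have hconst : D.eval 0 =
      (-1) ^ (m + 1) * (m.factorial * n.factorial / (m + n).factorial) * bernoulli (m + n) := by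
    rw [← hint]
    simp only [hD]
    rw [intervalIntegral.integral_sub ((hmul.fun_sub (hcont _ _ _)).intervalIntegrable _ _)
        ((hcont _ _ _).intervalIntegrable _ _),
      intervalIntegral.integral_sub (hmul.intervalIntegrable _ _)
        ((hcont _ _ _).intervalIntegrable _ _),
      hz m n m (by omega), hz m n n (by omega), integral_bernoulliFun_mul_bernoulliFun hm hn]
    ring
  rw [← hconst, ← hC x, hD x]
  simp only [← mul_assoc]
  ring

open Finset in
lemma sum_bernoulliFun_div (j : ℕ) {M : ℕ} (hM : M ≠ 0) :
    (∑ t ∈ range M, bernoulliFun j (t / M)) / M = bernoulli j / M ^ j := by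
  have h := bernoulliFun_mul j hM 0
  simp only [mul_zero, zero_add, bernoulliFun_eval_zero] at h
  have : (M : ℝ) ≠ 0 := Nat.cast_ne_zero.mpr hM
  rw [h]
  field_simp

open Finset in
lemma sum_range_mul_eq_sum_sum {A : Type*} [AddCommMonoid A] (d M : ℕ) (h : ℕ → A) :
    ∑ t ∈ range (d * M), h t = ∑ s ∈ range M, ∑ r ∈ range d, h (s + r * M) := by
  rw [sum_comm]
  induction d with
  | zero => simp
  | succ d ih =>
    rw [Nat.succ_mul, sum_range_add, ih, sum_range_succ]
    simp only [add_comm]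

open Finset in
lemma sum_exp_two_pi_mul_div {N : ℕ} (hN : N ≠ 0) (c : ℤ) :
    ∑ t ∈ range N, Complex.exp (2 * π * Complex.I * (c * t / N)) =
      if (N : ℤ) ∣ c then (N : ℂ) else 0 := by
  have hN' : (N : ℂ) ≠ 0 := Nat.cast_ne_zero.mpr hN
  have hpow (t : ℕ) : Complex.exp (2 * π * Complex.I * (c * t / N)) =
      Complex.exp (2 * π * Complex.I * (c / N)) ^ t := by
    rw [← Complex.exp_nat_mul]; congr 1; ring
  simp only [hpow]
  have hone : Complex.exp (2 * π * Complex.I * (c / N)) = 1 ↔ (N : ℤ) ∣ c := by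
    rw [Complex.exp_eq_one_iff]
    constructor
    · rintro ⟨n, hn⟩
      refine ⟨n, ?_⟩
      have : (c : ℂ) / N = n := by
        apply mul_left_cancel₀ Complex.two_pi_I_ne_zero
        rw [hn]; ring
      rw [div_eq_iff hN'] at this
      rw [mul_comm]
      exact_mod_cast this
    · rintro ⟨n, rfl⟩
      refine ⟨n, ?_⟩
      push_cast
      field_simp
  split_ifs with h
  · simp [hone.mpr h]
  · rw [geom_sum_eq (mt hone.mp h), ← hpow, div_eq_zero_iff, sub_eq_zero]
    left
    rw [mul_div_assoc, div_self hN', mul_one, mul_comm, Complex.exp_int_mul_two_pi_mul_I]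

/-- The normalized discrete Fourier transform of `t ↦ bernoulliFun m (t / N)`. -/
noncomputable def bernoulliDFT (N m a : ℕ) : ℂ :=
  (∑ t ∈ Finset.range N,
    Complex.exp (2 * π * Complex.I * (a * t / N)) * bernoulliFun m (t / N)) / N

open Finset in
lemma bernoulliDFT_mul_mul {d M : ℕ} (hd : d ≠ 0) (hM : M ≠ 0) (m b : ℕ) :
    bernoulliDFT (d * M) m (d * b) = bernoulliDFT M m b / d ^ m := by
  have hd' : (d : ℂ) ≠ 0 := Nat.cast_ne_zero.mpr hd
  have hM' : (M : ℂ) ≠ 0 := Nat.cast_ne_zero.mpr hM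
  have hinner (s : ℕ) : ∑ r ∈ range d,
      Complex.exp (2 * π * Complex.I * ((d * b : ℕ) * (s + r * M : ℕ) / (d * M : ℕ))) *
        bernoulliFun m ((s + r * M : ℕ) / (d * M : ℕ)) =
      d / d ^ m * (Complex.exp (2 * π * Complex.I * (b * s / M)) * bernoulliFun m (s / M)) := by
    have he (r : ℕ) :
        Complex.exp (2 * π * Complex.I * ((d * b : ℕ) * (s + r * M : ℕ) / (d * M : ℕ))) =
          Complex.exp (2 * π * Complex.I * (b * s / M)) := by
      rw [Complex.exp_eq_exp_iff_exists_int]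
      refine ⟨b * r, ?_⟩
      push_cast
      field_simp
    have hb : (bernoulliFun m (s / M) : ℂ) = d ^ m / d *
        ∑ r ∈ range d, (bernoulliFun m ((s + r * M : ℕ) / (d * M : ℕ)) : ℂ) := by
      have hd'' : (d : ℝ) ≠ 0 := Nat.cast_ne_zero.mpr hd
      have hM'' : (M : ℝ) ≠ 0 := Nat.cast_ne_zero.mpr hM
      have h := bernoulliFun_mul m hd ((s : ℝ) / (d * M))
      rw [show (d : ℝ) * (s / (d * M)) = s / M by field_simp] at h
      rw [h]
      push_cast
      congr 1
      refine sum_congr rfl fun r _ => ?_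
      congr 2
      field_simp
    simp only [he]
    rw [← mul_sum, hb]
    field_simp
  rw [bernoulliDFT, bernoulliDFT, sum_range_mul_eq_sum_sum]
  simp only [hinner]
  rw [← mul_sum]
  push_cast
  field_simp

open Finset in
lemma sum_bernoulliDFT_mul_conj {M : ℕ} (hM : M ≠ 0) (m n : ℕ) :
    ∑ b ∈ range M, bernoulliDFT M m b * (starRingEnd ℂ) (bernoulliDFT M n b) =
      (((∑ t ∈ range M, bernoulliFun m (t / M) * bernoulliFun n (t / M)) / M : ℝ) : ℂ) := by
  have hM' : (M : ℂ) ≠ 0 := Nat.cast_ne_zero.mpr hM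
  have hconj (b : ℕ) : (starRingEnd ℂ) (bernoulliDFT M n b) =
      (∑ u ∈ range M, Complex.exp (2 * π * Complex.I * (-(b * u / M))) *
        bernoulliFun n (u / M)) / M := by
    simp only [bernoulliDFT, map_div₀, map_sum, map_mul, Complex.conj_ofReal, map_natCast,
      ← Complex.exp_conj, Complex.conj_I, Complex.conj_ofNat]
    congr 1
    refine sum_congr rfl fun u _ => ?_
    congr 2
    ring
  have hterm (b : ℕ) : bernoulliDFT M m b * (starRingEnd ℂ) (bernoulliDFT M n b) =
      ∑ t ∈ range M, ∑ u ∈ range M,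
        Complex.exp (2 * π * Complex.I * (((t - u : ℤ) : ℂ) * b / M)) *
          (bernoulliFun m (t / M) * bernoulliFun n (u / M) / (M * M)) := by
    rw [hconj, bernoulliDFT, div_mul_div_comm, sum_mul_sum, sum_div]
    refine sum_congr rfl fun t _ => ?_
    rw [sum_div]
    refine sum_congr rfl fun u _ => ?_
    rw [show 2 * π * Complex.I * (((t - u : ℤ) : ℂ) * b / M) =
      2 * π * Complex.I * (b * t / M) + 2 * π * Complex.I * (-(b * u / M)) by push_cast; ring,
      Complex.exp_add]
    ring
  simp only [hterm]
  rw [sum_comm]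
  rw [sum_div, Complex.ofReal_sum]
  refine sum_congr rfl fun t ht => ?_
  rw [sum_comm, sum_eq_single_of_mem t ht]
  · rw [← sum_mul, sum_exp_two_pi_mul_div hM, if_pos (by simp)]
    push_cast
    field_simp
  · intro u hu hut
    rw [← sum_mul, sum_exp_two_pi_mul_div hM, if_neg, zero_mul]
    rw [mem_range] at ht hu
    intro hdvd
    apply hut
    have := Int.eq_zero_of_abs_lt_dvd hdvd (by rw [abs_lt]; omega)
    omega

open Finset ArithmeticFunction in
lemma sum_coprime_eq_sum_moebius_mul {R : Type*} [CommRing R] {N : ℕ} (hN : N ≠ 0) (h : ℕ → R) :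
    ∑ a ∈ range N with a.Coprime N, h a =
      ∑ d ∈ N.divisors, (moebius d : R) * ∑ b ∈ range (N / d), h (d * b) := by
  have hind (a : ℕ) : ∑ d ∈ N.divisors, (if d ∣ a then (moebius d : R) else 0) =
      if a.Coprime N then 1 else 0 := by
    rw [← sum_filter]
    have hg : a.gcd N ≠ 0 := Nat.gcd_ne_zero_right hN
    have : N.divisors.filter (· ∣ a) = (a.gcd N).divisors := by
      ext d
      simp only [mem_filter, Nat.mem_divisors, Nat.dvd_gcd_iff]
      tauto
    rw [this, ← Int.cast_sum]
    have hm := congrArg (fun F : ArithmeticFunction ℤ => F (a.gcd N)) coe_zeta_mul_moebius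
    simp only [coe_zeta_mul_apply, one_apply] at hm
    rw [hm]
    simp [Nat.Coprime]
  have hsum {d : ℕ} (hd : d ∈ N.divisors) :
      ∑ b ∈ range (N / d), h (d * b) = ∑ a ∈ range N, if d ∣ a then h a else 0 := by
    have hd0 : 0 < d := Nat.pos_of_mem_divisors hd
    obtain ⟨M, rfl⟩ := (Nat.mem_divisors.mp hd).1
    rw [Nat.mul_div_cancel_left _ hd0, ← sum_filter]
    refine sum_bij (fun b _ => d * b) ?_ ?_ ?_ ?_
    · intro b hb
      simp only [mem_range, mem_filter] at hb ⊢
      exact ⟨Nat.mul_lt_mul_of_pos_left hb hd0, dvd_mul_right _ _⟩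
    · intro a _ b _ hab
      exact Nat.eq_of_mul_eq_mul_left hd0 hab
    · intro a ha
      simp only [mem_range, mem_filter] at ha
      obtain ⟨b, rfl⟩ := ha.2
      exact ⟨b, mem_range.mpr (Nat.lt_of_mul_lt_mul_left ha.1), rfl⟩
    · intro b _
      rfl
  have hrhs : ∑ d ∈ N.divisors, (moebius d : R) * ∑ b ∈ range (N / d), h (d * b) =
      ∑ d ∈ N.divisors, (moebius d : R) * ∑ a ∈ range N, if d ∣ a then h a else 0 :=
    sum_congr rfl fun d hd => by rw [hsum hd]
  rw [hrhs, sum_filter]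
  simp only [mul_sum]
  rw [sum_comm]
  refine sum_congr rfl fun a _ => ?_
  have := congrArg (· * h a) (hind a)
  simp only [sum_mul, ite_mul, one_mul, zero_mul] at this
  simp only [mul_ite, mul_zero]
  exact this.symm

open Finset ArithmeticFunction in
lemma sum_divisors_moebius_div_pow {N : ℕ} (hN : N ≠ 0) (s : ℕ) :
    ∑ d ∈ N.divisors, (moebius d : ℂ) / (d : ℂ) ^ s =
      ∏ p ∈ N.primeFactors, (1 - 1 / (p : ℂ) ^ s) := by
  let F : ArithmeticFunction ℂ := ⟨fun d => if d = 0 then 0 else 1 / (d : ℂ) ^ s, by simp⟩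
  have hF {d : ℕ} (hd : d ≠ 0) : F d = 1 / (d : ℂ) ^ s := by simp [F, hd]
  have hmul : F.IsMultiplicative := by
    rw [IsMultiplicative.iff_ne_zero]
    refine ⟨by simp [hF], fun {a b} ha hb _ => ?_⟩
    rw [hF ha, hF hb, hF (mul_ne_zero ha hb)]
    push_cast
    rw [mul_pow]
    field_simp
  set r := ∏ p ∈ N.primeFactors, p with hr
  have hprime : ∀ p ∈ N.primeFactors, p.Prime := fun p hp => Nat.prime_of_mem_primeFactors hp
  have hrpf : r.primeFactors = N.primeFactors := Nat.primeFactors_prod hprime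
  have hrsq : Squarefree r :=
    Finset.squarefree_prod_of_pairwise_isCoprime
      (fun p hp q hq hpq => Nat.coprime_iff_isRelPrime.mp <|
        (Nat.coprime_primes (hprime p hp) (hprime q hq)).mpr hpq)
      fun p hp => (hprime p hp).prime.squarefree
  have hr0 : r ≠ 0 := hrsq.ne_zero
  have hrN : r ∣ N := Nat.prod_primeFactors_dvd N
  have key := IsMultiplicative.prodPrimeFactors_one_sub_of_squarefree F hmul hrsq
  rw [hrpf] at key
  rw [prod_congr rfl fun p hp => by rw [← hF (hprime p hp).ne_zero], key]
  rw [← sum_subset (Nat.divisors_subset_of_dvd hN hrN)]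
  · refine sum_congr rfl fun d hd => ?_
    rw [hF (Nat.pos_of_mem_divisors hd).ne', mul_one_div]
  · intro d hd hdr
    rw [moebius_eq_zero_of_not_squarefree, Int.cast_zero, zero_div]
    intro hsq
    apply hdr
    rw [Nat.mem_divisors]
    refine ⟨?_, hr0⟩
    rw [← Nat.prod_primeFactors_of_squarefree hsq]
    exact prod_dvd_prod_of_subset _ _ _ (Nat.primeFactors_mono (Nat.mem_divisors.mp hd).1 hN)

open Finset in
lemma sum_apply_mul_bernoulliDFT_of_two_le {N : ℕ} [NeZero N] (χ : DirichletCharacter ℂ N)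
    {m : ℕ} (hm : 2 ≤ m) :
    -(2 * π * Complex.I) ^ m / m.factorial * ∑ a : ZMod N, χ a * bernoulliDFT N m a.val =
      (χ (-1) + (-1) ^ m) * χ.LFunction m := by
  have hN : N ≠ 0 := NeZero.ne N
  have hN' : (N : ℂ) ≠ 0 := Nat.cast_ne_zero.mpr hN
  have hre : 1 < (m : ℂ).re := by simpa using (by omega : 1 < m)
  have hL := (ZMod.LSeriesSummable_of_one_lt_re (N := N) χ hre).LSeriesHasSum
  rw [← ZMod.LFunction_eq_LSeries χ hre] at hL
  have hE (t : ℕ) (ht : t ∈ range N) :=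
    hasSum_one_div_nat_pow_mul_fourier (x := (t / N : ℝ)) hm
      ⟨by positivity, div_le_one_of_le₀ (by exact_mod_cast (mem_range.mp ht).le) (by positivity)⟩
  have hS : HasSum (fun k : ℕ => ∑ a : ZMod N, χ a * ((∑ t ∈ range N,
        Complex.exp (2 * π * Complex.I * (a.val * t / N)) * (1 / (k : ℂ) ^ m *
          (fourier k ((t / N : ℝ) : UnitAddCircle) +
            (-1) ^ m * fourier (-k) ((t / N : ℝ) : UnitAddCircle)))) / N))
      (∑ a : ZMod N, χ a * ((∑ t ∈ range N,
        Complex.exp (2 * π * Complex.I * (a.val * t / N)) *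
          (-(2 * π * Complex.I) ^ m / m.factorial * bernoulliFun m (t / N))) / N)) :=
    hasSum_sum fun a _ => ((hasSum_sum fun t ht => (hE t ht).mul_left _).div_const _).mul_left _
  have hlhs : -(2 * π * Complex.I) ^ m / m.factorial *
      ∑ a : ZMod N, χ a * bernoulliDFT N m a.val = ∑ a : ZMod N, χ a * ((∑ t ∈ range N,
        Complex.exp (2 * π * Complex.I * (a.val * t / N)) *
          (-(2 * π * Complex.I) ^ m / m.factorial * bernoulliFun m (t / N))) / N) := by
    rw [mul_sum]
    refine sum_congr rfl fun a _ => ?_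
    rw [bernoulliDFT, mul_left_comm, ← mul_div_assoc, mul_sum]
    congr 2
    exact sum_congr rfl fun t _ => by ring
  rw [hlhs]
  refine hS.unique ((hL.mul_left (χ (-1) + (-1) ^ m)).congr_fun fun k => ?_)
  have hin (a : ZMod N) : (∑ t ∈ range N,
        Complex.exp (2 * π * Complex.I * (a.val * t / N)) * (1 / (k : ℂ) ^ m *
          (fourier k ((t / N : ℝ) : UnitAddCircle) +
            (-1) ^ m * fourier (-k) ((t / N : ℝ) : UnitAddCircle)))) / N =
      1 / (k : ℂ) ^ m * ((if a = -k then 1 else 0) + (-1) ^ m * if a = k then 1 else 0) := by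
    have hdvd1 : (N : ℤ) ∣ (a.val + k : ℤ) ↔ a = -k := by
      rw [← ZMod.intCast_zmod_eq_zero_iff_dvd, eq_neg_iff_add_eq_zero]
      simp
    have hdvd2 : (N : ℤ) ∣ (a.val - k : ℤ) ↔ a = k := by
      rw [← ZMod.intCast_zmod_eq_zero_iff_dvd]
      simp [sub_eq_zero]
    have e1 := sum_exp_two_pi_mul_div hN (a.val + k)
    have e2 := sum_exp_two_pi_mul_div hN (a.val - k)
    simp only [hdvd1] at e1
    simp only [hdvd2] at e2
    have hterm (t : ℕ) : Complex.exp (2 * π * Complex.I * (a.val * t / N)) * (1 / (k : ℂ) ^ m *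
          (fourier k ((t / N : ℝ) : UnitAddCircle) +
            (-1) ^ m * fourier (-k) ((t / N : ℝ) : UnitAddCircle))) =
        1 / (k : ℂ) ^ m * Complex.exp (2 * π * Complex.I * (((a.val + k : ℤ) : ℂ) * t / N)) +
        1 / (k : ℂ) ^ m * (-1) ^ m *
          Complex.exp (2 * π * Complex.I * (((a.val - k : ℤ) : ℂ) * t / N)) := by
      rw [fourier_coe_apply, fourier_coe_apply,
        show 2 * π * Complex.I * (((a.val + k : ℤ) : ℂ) * t / N) =
          2 * π * Complex.I * (a.val * t / N) + 2 * π * Complex.I * (k : ℤ) * (t / N : ℝ) / (1 : ℝ)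
          by push_cast; ring,
        show 2 * π * Complex.I * (((a.val - k : ℤ) : ℂ) * t / N) =
          2 * π * Complex.I * (a.val * t / N) +
            2 * π * Complex.I * (-k : ℤ) * (t / N : ℝ) / (1 : ℝ)
          by push_cast; ring, Complex.exp_add, Complex.exp_add]
      ring
    simp only [hterm]
    rw [sum_add_distrib, ← mul_sum, ← mul_sum, e1, e2]
    split_ifs <;> field_simp <;> ring
  simp only [hin]
  simp only [mul_add, mul_ite, mul_one, mul_zero, sum_add_distrib, sum_ite_eq',
    mem_univ, if_true]
  rcases eq_or_ne k 0 with rfl | hk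
  · simp [show m ≠ 0 by omega]
  · rw [LSeries.term_of_ne_zero hk, Complex.cpow_natCast, ← neg_one_mul (k : ZMod N), map_mul]
    ring

lemma Real.abs_rpow_neg_sub_rpow_neg_le {u x y s : ℝ} (hu : 0 < u) (hx : u ≤ x) (hy : u ≤ y)
    (hs : 0 ≤ s) : |x ^ (-s) - y ^ (-s)| ≤ s * u ^ (-s - 1) * |x - y| := by
  have h := (convex_Ici u).norm_image_sub_le_of_norm_hasDerivWithin_le
    (f := fun t : ℝ => t ^ (-s)) (f' := fun t => -s * t ^ (-s - 1)) (C := s * u ^ (-s - 1))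
    (fun t ht => (Real.hasDerivAt_rpow_const
      (Or.inl (hu.trans_le ht).ne')).hasDerivWithinAt) (fun t ht => ?_) hy hx
  · simpa [Real.norm_eq_abs] using h
  · have ht0 : 0 < t := hu.trans_le ht
    rw [norm_mul, norm_neg, Real.norm_of_nonneg hs, Real.norm_of_nonneg (by positivity)]
    exact mul_le_mul_of_nonneg_left (Real.rpow_le_rpow_of_nonpos hu ht (by linarith)) hs

open HurwitzZeta Filter Topology Set in
lemma hasSum_nat_hurwitzZetaOdd_one {a : ℝ} (ha : a ∈ Ioo (0 : ℝ) 1) :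
    HasSum (fun n : ℕ => (1 / (n + a : ℂ) - 1 / (n + 1 - a : ℂ)) / 2) (hurwitzZetaOdd a 1) := by
  obtain ⟨ha0, ha1⟩ := ha
  set δ := min a (1 - a) with hδ
  have hδ0 : 0 < δ := lt_min ha0 (by linarith)
  have hδa : δ ≤ a := min_le_left _ _
  have hδa' : δ ≤ 1 - a := min_le_right _ _
  let F : ℝ → ℕ → ℂ := fun s n => (1 / (n + a : ℂ) ^ (s : ℂ) - 1 / (n + 1 - a : ℂ) ^ (s : ℂ)) / 2
  have hF (s : ℝ) (n : ℕ) :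
      F s n = (((n + a : ℝ) ^ (-s) - (n + 1 - a : ℝ) ^ (-s)) / 2 : ℝ) := by
    have h1 : (0 : ℝ) ≤ n + a := by positivity
    have h2 : (0 : ℝ) ≤ n + 1 - a := by have : (0:ℝ) ≤ n := n.cast_nonneg; linarith
    rw [Real.rpow_neg h1, Real.rpow_neg h2]
    push_cast [Complex.ofReal_cpow h1, Complex.ofReal_cpow h2]
    simp [F]
  have hbound (s : ℝ) (hs : s ∈ Icc (1 : ℝ) 2) (n : ℕ) :
      ‖F s n‖ ≤ δ⁻¹ ^ 3 * (1 / ((n + 1 : ℕ) : ℝ) ^ 2) := by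
    have hn : (0 : ℝ) ≤ n := n.cast_nonneg
    have hu : 0 < δ * (n + 1) := by positivity
    have h1 : δ * (n + 1) ≤ n + a := by nlinarith
    have h2 : δ * (n + 1) ≤ n + 1 - a := by nlinarith
    have h := Real.abs_rpow_neg_sub_rpow_neg_le hu h1 h2 (by linarith [hs.1] : 0 ≤ s)
    have hxy : |(n + a : ℝ) - (n + 1 - a)| ≤ 1 := abs_le.mpr ⟨by linarith, by linarith⟩
    have hδn : (δ * (n + 1)) ^ (-s - 1) ≤ δ⁻¹ ^ 3 * (1 / ((n + 1 : ℕ) : ℝ) ^ 2) := by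
      rw [Real.mul_rpow hδ0.le (by positivity)]
      gcongr
      · calc δ ^ (-s - 1) ≤ δ ^ (-(3 : ℕ) : ℝ) :=
              Real.rpow_le_rpow_of_exponent_ge hδ0 (by linarith) (by push_cast; linarith [hs.2])
          _ = δ⁻¹ ^ 3 := by rw [Real.rpow_neg hδ0.le, Real.rpow_natCast, inv_pow]
      · calc (n + 1 : ℝ) ^ (-s - 1) ≤ (n + 1 : ℝ) ^ (-(2 : ℕ) : ℝ) :=
              Real.rpow_le_rpow_of_exponent_le (by linarith) (by push_cast; linarith [hs.1])
          _ = 1 / ((n + 1 : ℕ) : ℝ) ^ 2 := by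
              rw [Real.rpow_neg (by positivity), Real.rpow_natCast, one_div]; push_cast; rfl
    rw [hF, Complex.norm_real, Real.norm_eq_abs, abs_div, abs_two]
    have h3 : s * (δ * (n + 1)) ^ (-s - 1) * |(n + a : ℝ) - (n + 1 - a)| ≤
        2 * (δ⁻¹ ^ 3 * (1 / ((n + 1 : ℕ) : ℝ) ^ 2)) * 1 := by
      gcongr
      exact hs.2
    linarith
  have hsum : Summable fun n : ℕ => δ⁻¹ ^ 3 * (1 / ((n + 1 : ℕ) : ℝ) ^ 2) :=
    ((summable_nat_add_iff (f := fun n : ℕ => 1 / (n : ℝ) ^ 2) 1).mpr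
      (Real.summable_one_div_nat_pow.mpr one_lt_two)).mul_left _
  have hF1 : Summable (F 1) := Summable.of_norm_bounded hsum (hbound 1 ⟨le_rfl, one_le_two⟩)
  have hlim1 : Tendsto (fun s : ℝ => ∑' n, F s n) (𝓝[>] 1) (𝓝 (∑' n, F 1 n)) := by
    refine tendsto_tsum_of_dominated_convergence hsum (fun n => ?_) ?_
    · have h1 : (n + a : ℝ) ≠ 0 := by positivity
      have h2 : (n + 1 - a : ℝ) ≠ 0 := by
        have : (0:ℝ) ≤ n := n.cast_nonneg
        linarith
      simp only [hF]
      have hc : Continuous fun s : ℝ =>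
          (((n + a : ℝ) ^ (-s) - (n + 1 - a : ℝ) ^ (-s)) / 2 : ℝ) :=
        ((((Real.continuous_const_rpow h1).comp continuous_neg).sub
          ((Real.continuous_const_rpow h2).comp continuous_neg)).div_const 2)
      exact ((Complex.continuous_ofReal.comp hc).tendsto 1).mono_left nhdsWithin_le_nhds
    · filter_upwards [Ioc_mem_nhdsGT (one_lt_two : (1 : ℝ) < 2)] with s hs n
      exact hbound s ⟨hs.1.le, hs.2⟩ n
  have hlim2 : Tendsto (fun s : ℝ => ∑' n, F s n) (𝓝[>] 1) (𝓝 (hurwitzZetaOdd a 1)) := by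
    have hc : Continuous fun s : ℝ => hurwitzZetaOdd a s :=
      (differentiable_hurwitzZetaOdd a).continuous.comp Complex.continuous_ofReal
    have := (hc.tendsto 1).mono_left (nhdsWithin_le_nhds (s := Ioi (1 : ℝ)))
    rw [Complex.ofReal_one] at this
    refine this.congr' ?_
    filter_upwards [self_mem_nhdsWithin] with s hs
    exact (hasSum_nat_hurwitzZetaOdd_of_mem_Icc ⟨ha0.le, ha1.le⟩
      (by simpa using hs)).tsum_eq.symm
  have h := hF1.hasSum
  rw [tendsto_nhds_unique hlim1 hlim2] at h
  simpa [F] using h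

open HurwitzZeta Filter Topology Set in
lemma hurwitzZetaOdd_one {a : ℝ} (ha : a ∈ Ioo (0 : ℝ) 1) :
    hurwitzZetaOdd a 1 = π * Complex.cot (π * a) / 2 := by
  have ha' : (a : ℂ) ∈ Complex.integerComplement := by
    rw [Complex.mem_integerComplement_iff]
    rintro ⟨n, hn⟩
    have hn' : (n : ℝ) = a := by exact_mod_cast hn
    have h1 : (0 : ℝ) < n := hn' ▸ ha.1
    have h2 : (n : ℝ) < 1 := hn' ▸ ha.2
    have h3 : 0 < n := by exact_mod_cast h1
    have h4 : n < 1 := by exact_mod_cast h2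
    omega
  have h1 := (hasSum_nat_hurwitzZetaOdd_one ha).tendsto_sum_nat
  have h2 := tendsto_logDeriv_euler_cot_sub ha'
  have h3 : Tendsto (fun M : ℕ => 1 / ((a : ℂ) + M)) atTop (𝓝 0) := by
    simp only [one_div]
    refine tendsto_inv₀_cobounded.comp ?_
    rw [← tendsto_norm_atTop_iff_cobounded]
    have : Tendsto (fun M : ℕ => a + (M : ℝ)) atTop atTop :=
      tendsto_atTop_add_const_left _ _ tendsto_natCast_atTop_atTop
    refine this.congr fun M => ?_
    rw [← Complex.ofReal_natCast, ← Complex.ofReal_add, Complex.norm_real, Real.norm_of_nonneg]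
    have := ha.1
    positivity
  have h4 := (((h2.const_add (1 / (a : ℂ))).sub h3).div_const 2)
  refine (tendsto_nhds_unique (h4.congr fun M => ?_) h1).symm.trans ?_
  · induction M with
    | zero => simp
    | succ M ih =>
      rw [Finset.sum_range_succ, Finset.sum_range_succ, ← ih]
      have e : (M + 1 - a : ℂ) = -(a - (M + 1)) := by ring
      rw [e]
      push_cast [cotTerm]
      rw [one_div_neg_eq_neg_one_div, add_comm (M : ℂ) a]
      ring
  · ring

open Finset in
lemma sum_range_mul_pow_mul_sub_one {R : Type*} [CommRing R] (z : R) (N : ℕ) :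
    (∑ t ∈ range N, (t : R) * z ^ t) * (z - 1) = N * z ^ N - z * ∑ t ∈ range N, z ^ t := by
  induction N with
  | zero => simp
  | succ N ih =>
    rw [sum_range_succ, sum_range_succ, add_mul, ih, pow_succ]
    push_cast
    ring

open Finset HurwitzZeta in
lemma bernoulliDFT_one {N a : ℕ} (ha0 : 0 < a) (haN : a < N) :
    bernoulliDFT N 1 a =
      (hurwitzZetaOdd ((a / N : ℝ) : UnitAddCircle) 1 / (π * Complex.I) - 1 / 2) / N := by
  have hN : N ≠ 0 := by omega
  have hN' : (N : ℂ) ≠ 0 := Nat.cast_ne_zero.mpr hN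
  set z := Complex.exp (2 * π * Complex.I * (a / N)) with hz
  have hpow (t : ℕ) : Complex.exp (2 * π * Complex.I * (a * t / N)) = z ^ t := by
    rw [hz, ← Complex.exp_nat_mul]
    congr 1
    ring
  have hgeom : ∑ t ∈ range N, z ^ t = 0 := by
    have h := sum_exp_two_pi_mul_div hN a
    rw [if_neg (fun h => absurd (Nat.le_of_dvd ha0 (by exact_mod_cast h)) (by omega))] at h
    simpa only [Int.cast_natCast, hpow] using h
  have hzN : z ^ N = 1 := by
    rw [← hpow, mul_div_cancel_right₀ _ hN', mul_comm]
    exact Complex.exp_nat_mul_two_pi_mul_I a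
  have hz1 : z - 1 ≠ 0 := by
    intro h
    rw [sub_eq_zero.mp h] at hgeom
    simp [hN] at hgeom
  have hsum := sum_range_mul_pow_mul_sub_one z N
  rw [hgeom, hzN, mul_zero, sub_zero, mul_one, ← eq_div_iff hz1] at hsum
  have hcot : hurwitzZetaOdd ((a / N : ℝ) : UnitAddCircle) 1 =
      π * Complex.I * (1 / (z - 1) + 1 / 2) := by
    have hN0 : (0 : ℝ) < N := by positivity
    rw [hurwitzZetaOdd_one ⟨by positivity, (div_lt_one hN0).mpr (by exact_mod_cast haN)⟩,
      Complex.cot_eq_exp_ratio]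
    have e : Complex.exp (2 * Complex.I * (π * ((a / N : ℝ) : ℂ))) = z := by
      rw [hz]
      push_cast
      congr 1
      ring
    rw [e]
    have hz1' : 1 - z ≠ 0 := by rwa [← neg_ne_zero, neg_sub]
    field_simp
    rw [Complex.I_sq]
    ring
  have hπ : (π : ℂ) * Complex.I ≠ 0 := by simp [Real.pi_ne_zero]
  rw [hcot, mul_div_cancel_left₀ _ hπ, bernoulliDFT]
  congr 1
  have hterm (t : ℕ) : Complex.exp (2 * π * Complex.I * (a * t / N)) * bernoulliFun 1 (t / N) =
      1 / N * (t * z ^ t) - 1 / 2 * z ^ t := by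
    rw [hpow, bernoulliFun_one]
    push_cast
    ring
  simp only [hterm]
  rw [sum_sub_distrib, ← mul_sum, ← mul_sum, hgeom, hsum]
  field_simp
  ring

open Finset in
lemma sum_apply_mul_bernoulliDFT_one {N : ℕ} [NeZero N] {χ : DirichletCharacter ℂ N}
    (hχ : χ.Odd) :
    -(2 * π * Complex.I) * ∑ a : ZMod N, χ a * bernoulliDFT N 1 a.val = -2 * χ.LFunction 1 := by
  have hodd : Function.Odd (χ : ZMod N → ℂ) := hχ.to_fun
  have hN' : (N : ℂ) ≠ 0 := Nat.cast_ne_zero.mpr (NeZero.ne N)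
  have hsum : ∑ a : ZMod N, χ a = 0 := hodd.sum_eq_zero
  have hπ : (π : ℂ) ≠ 0 := by simp [Real.pi_ne_zero]
  have hterm (a : ZMod N) : χ a * bernoulliDFT N 1 a.val =
      1 / (π * Complex.I * N) * (χ a * HurwitzZeta.hurwitzZetaOdd (ZMod.toAddCircle a) 1) -
        1 / (2 * N) * χ a := by
    rcases eq_or_ne a 0 with rfl | ha
    · have h0 : χ 0 = 0 := by simpa [eq_neg_iff_add_eq_zero, ← two_mul] using hodd 0
      simp [h0]
    · rw [bernoulliDFT_one (ZMod.val_pos.mpr ha) (ZMod.val_lt a), ZMod.toAddCircle_apply]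
      field_simp
  simp only [hterm]
  rw [sum_sub_distrib, ← mul_sum, ← mul_sum, hsum, DirichletCharacter.LFunction,
    ZMod.LFunction_def_odd hodd, Complex.cpow_neg_one]
  field_simp
  ring

open Finset in
lemma sum_bernoulliFun_mul_bernoulliFun_div {m n M : ℕ} (hm : 1 ≤ m) (hn : 1 ≤ n) (hM : M ≠ 0) :
    (∑ t ∈ range M, bernoulliFun m (t / M) * bernoulliFun n (t / M)) / M =
      ∑ k ∈ range (m / 2 + 1), (m.choose (2 * k) : ℝ) * (bernoulli (2 * k) : ℝ) *
        (n / ((m + n - 2 * k : ℕ) : ℝ) * (bernoulli (m + n - 2 * k) / M ^ (m + n - 2 * k))) +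
      ∑ k ∈ range (n / 2 + 1), (n.choose (2 * k) : ℝ) * (bernoulli (2 * k) : ℝ) *
        (m / ((m + n - 2 * k : ℕ) : ℝ) * (bernoulli (m + n - 2 * k) / M ^ (m + n - 2 * k))) +
      (-1) ^ (m + 1) * (m.factorial * n.factorial / (m + n).factorial) * bernoulli (m + n) := by
  have hM' : (M : ℝ) ≠ 0 := Nat.cast_ne_zero.mpr hM
  simp only [bernoulliFun_mul_bernoulliFun hm hn, ← sum_bernoulliFun_div _ hM, sum_add_distrib,
    add_div, sum_const, card_range, nsmul_eq_mul, mul_div_cancel_left₀ _ hM']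
  congr 2 <;>
  · rw [sum_comm, sum_div]
    refine sum_congr rfl fun k _ => ?_
    rw [← mul_sum, ← mul_sum, mul_div_assoc, mul_div_assoc]

open Finset ArithmeticFunction in
lemma sum_divisors_moebius_mul_div_pow {N s j : ℕ} (hN : N ≠ 0) (hj : j ≤ s) (c : ℂ) :
    ∑ d ∈ N.divisors, (moebius d : ℂ) * (1 / (d : ℂ) ^ s * (c / ((N / d : ℕ) : ℂ) ^ (s - j))) =
      c * (∏ p ∈ N.primeFactors, (1 - 1 / (p : ℂ) ^ j)) / (N : ℂ) ^ (s - j) := by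
  rw [← sum_divisors_moebius_div_pow hN, mul_sum, sum_div]
  refine sum_congr rfl fun d hd => ?_
  have hd0 : (d : ℂ) ≠ 0 := Nat.cast_ne_zero.mpr (Nat.pos_of_mem_divisors hd).ne'
  have hN' : (N : ℂ) ≠ 0 := Nat.cast_ne_zero.mpr hN
  rw [Nat.cast_div (Nat.dvd_of_mem_divisors hd) hd0, div_pow]
  nth_rewrite 1 [← Nat.sub_add_cancel hj]
  rw [pow_add]
  field_simp

open Finset ArithmeticFunction in
lemma sum_coprime_bernoulliDFT_mul_conj {m n N : ℕ} (hm : 1 ≤ m) (hn : 1 ≤ n) (hN : N ≠ 0) :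
    ∑ a ∈ range N with a.Coprime N,
        bernoulliDFT N m a * (starRingEnd ℂ) (bernoulliDFT N n a) =
      ∑ k ∈ range (m / 2 + 1), (m.choose (2 * k) : ℂ) * (bernoulli (2 * k) : ℂ) *
        (n / ((m + n - 2 * k : ℕ) : ℂ) * bernoulli (m + n - 2 * k)) *
        (∏ p ∈ N.primeFactors, (1 - 1 / (p : ℂ) ^ (2 * k))) / (N : ℂ) ^ (m + n - 2 * k) +
      ∑ k ∈ range (n / 2 + 1), (n.choose (2 * k) : ℂ) * (bernoulli (2 * k) : ℂ) *
        (m / ((m + n - 2 * k : ℕ) : ℂ) * bernoulli (m + n - 2 * k)) *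
        (∏ p ∈ N.primeFactors, (1 - 1 / (p : ℂ) ^ (2 * k))) / (N : ℂ) ^ (m + n - 2 * k) +
      (-1) ^ (m + 1) * (m.factorial * n.factorial / (m + n).factorial) * bernoulli (m + n) *
        ∏ p ∈ N.primeFactors, (1 - 1 / (p : ℂ) ^ (m + n)) := by
  have hd (d : ℕ) (hd : d ∈ N.divisors) :
      ∑ b ∈ range (N / d), bernoulliDFT N m (d * b) *
        (starRingEnd ℂ) (bernoulliDFT N n (d * b)) =
      ∑ k ∈ range (m / 2 + 1), 1 / (d : ℂ) ^ (m + n) * ((m.choose (2 * k) : ℂ) *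
        (bernoulli (2 * k) : ℂ) * (n / ((m + n - 2 * k : ℕ) : ℂ) * bernoulli (m + n - 2 * k)) /
          ((N / d : ℕ) : ℂ) ^ (m + n - 2 * k)) +
      ∑ k ∈ range (n / 2 + 1), 1 / (d : ℂ) ^ (m + n) * ((n.choose (2 * k) : ℂ) *
        (bernoulli (2 * k) : ℂ) * (m / ((m + n - 2 * k : ℕ) : ℂ) * bernoulli (m + n - 2 * k)) /
          ((N / d : ℕ) : ℂ) ^ (m + n - 2 * k)) +
      1 / (d : ℂ) ^ (m + n) * ((-1) ^ (m + 1) *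
        (m.factorial * n.factorial / (m + n).factorial) * bernoulli (m + n) /
          ((N / d : ℕ) : ℂ) ^ (m + n - (m + n))) := by
    have hd0 : d ≠ 0 := (Nat.pos_of_mem_divisors hd).ne'
    have hM0 : N / d ≠ 0 := (Nat.div_pos (Nat.divisor_le hd) (Nat.pos_of_ne_zero hd0)).ne'
    have hg (j b : ℕ) : bernoulliDFT N j (d * b) = bernoulliDFT (N / d) j b / d ^ j := by
      rw [← bernoulliDFT_mul_mul hd0 hM0, Nat.mul_div_cancel' (Nat.dvd_of_mem_divisors hd)]
    have hterm (b : ℕ) : bernoulliDFT N m (d * b) *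
        (starRingEnd ℂ) (bernoulliDFT N n (d * b)) =
        1 / (d : ℂ) ^ (m + n) * (bernoulliDFT (N / d) m b *
          (starRingEnd ℂ) (bernoulliDFT (N / d) n b)) := by
      rw [hg, hg, map_div₀, map_pow, map_natCast, pow_add]
      ring
    simp only [hterm]
    rw [← mul_sum, ← mul_sum, ← mul_sum, ← mul_add, ← mul_add, sum_bernoulliDFT_mul_conj hM0,
      sum_bernoulliFun_mul_bernoulliFun_div hm hn hM0, Nat.sub_self, pow_zero, div_one]
    push_cast
    simp only [mul_div_assoc]
  rw [sum_coprime_eq_sum_moebius_mul hN, sum_congr rfl fun d h => by rw [hd d h]]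
  simp only [mul_add, sum_add_distrib, mul_sum]
  rw [sum_comm, sum_comm (s := N.divisors) (t := range (n / 2 + 1)),
    sum_divisors_moebius_mul_div_pow hN le_rfl, Nat.sub_self, pow_zero, div_one]
  congr 2 <;>
  · refine sum_congr rfl fun k hk => ?_
    rw [mem_range] at hk
    rw [sum_divisors_moebius_mul_div_pow hN (by omega)]

open Finset in
lemma sum_dirichletCharacter_sum_mul_conj {N : ℕ} [NeZero N] (u v : ZMod N → ℂ) :
    ∑ χ : DirichletCharacter ℂ N, (∑ a, χ a * u a) * (starRingEnd ℂ) (∑ a, χ a * v a) =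
      N.totient * ∑ a : ZMod N with IsUnit a, u a * (starRingEnd ℂ) (v a) := by
  have hconj (χ : DirichletCharacter ℂ N) {b : ZMod N} (hb : IsUnit b) :
      (starRingEnd ℂ) (χ b) = χ b⁻¹ := by
    rw [starRingEnd_apply, MulChar.star_apply', MulChar.inv_apply_eq_inv']
    refine (eq_inv_of_mul_eq_one_left ?_).symm
    rw [← map_mul, ZMod.inv_mul_of_unit b hb, map_one]
  have horth (a b : ZMod N) : ∑ χ : DirichletCharacter ℂ N, χ a * (starRingEnd ℂ) (χ b) =
      if IsUnit b ∧ b = a then (N.totient : ℂ) else 0 := by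
    by_cases hb : IsUnit b
    · rw [← sum_congr rfl fun χ _ => by rw [mul_comm, hconj χ hb],
        DirichletCharacter.sum_char_inv_mul_char_eq ℂ hb]
      simp [hb]
    · simp [hb, MulChar.map_nonunit]
  calc
    _ = ∑ χ : DirichletCharacter ℂ N, ∑ a, ∑ b,
          u a * (starRingEnd ℂ) (v b) * (χ a * (starRingEnd ℂ) (χ b)) := by
      refine sum_congr rfl fun χ _ => ?_
      rw [map_sum, sum_mul_sum]
      refine sum_congr rfl fun a _ => sum_congr rfl fun b _ => ?_
      rw [map_mul]
      ring
    _ = ∑ a, ∑ b, u a * (starRingEnd ℂ) (v b) *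
          ∑ χ : DirichletCharacter ℂ N, χ a * (starRingEnd ℂ) (χ b) := by
      simp only [mul_sum]
      rw [sum_comm]
      exact sum_congr rfl fun a _ => sum_comm
    _ = _ := by
      simp only [horth]
      rw [mul_sum, sum_filter, sum_comm]
      refine sum_congr rfl fun b _ => ?_
      by_cases hb : IsUnit b
      · simp [hb, mul_comm]
      · simp [hb]

open Finset in
lemma ZMod.sum_isUnit_val {A : Type*} [AddCommMonoid A] {N : ℕ} [NeZero N] (h : ℕ → A) :
    ∑ a : ZMod N with IsUnit a, h a.val = ∑ a ∈ range N with a.Coprime N, h a := by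
  refine sum_nbij' ZMod.val (fun a => (a : ZMod N)) ?_ ?_ ?_ ?_ fun _ _ => rfl
  · intro a ha
    simp only [mem_filter, mem_univ, true_and, mem_range] at ha ⊢
    refine ⟨ZMod.val_lt a, ?_⟩
    rwa [← ZMod.isUnit_iff_coprime, ZMod.natCast_zmod_val]
  · intro a ha
    simp only [mem_filter, mem_univ, true_and, mem_range] at ha ⊢
    exact (ZMod.isUnit_iff_coprime a N).mpr ha.2
  · intro a _
    exact ZMod.natCast_zmod_val a
  · intro a ha
    simp only [mem_filter, mem_range] at ha
    exact ZMod.val_cast_of_lt ha.1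

open Finset in
lemma sum_apply_mul_bernoulliDFT {N m : ℕ} [NeZero N] {χ : DirichletCharacter ℂ N} (hm : 1 ≤ m)
    (hχ : χ (-1) = (-1) ^ m) :
    -(2 * π * Complex.I) ^ m / m.factorial * ∑ a : ZMod N, χ a * bernoulliDFT N m a.val =
      2 * (-1) ^ m * χ.LFunction m := by
  rcases hm.eq_or_lt with rfl | hm
  · have h := sum_apply_mul_bernoulliDFT_one (χ := χ) (hχ.trans (pow_one _))
    simpa using h
  · rw [sum_apply_mul_bernoulliDFT_of_two_le χ hm, hχ]
    ring

open Finset in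
lemma sum_apply_mul_bernoulliDFT_eq_zero {N m : ℕ} [NeZero N] {χ : DirichletCharacter ℂ N}
    (hm : 2 ≤ m) (hχ : χ (-1) ≠ (-1) ^ m) : ∑ a : ZMod N, χ a * bernoulliDFT N m a.val = 0 := by
  have h := sum_apply_mul_bernoulliDFT_of_two_le χ hm
  have hs : χ (-1) + (-1) ^ m = 0 := by
    rcases χ.even_or_odd with he | he <;> rcases Nat.even_or_odd m with hm | hm <;>
      simp_all [DirichletCharacter.Even, DirichletCharacter.Odd]
  rw [hs, zero_mul, mul_eq_zero] at h
  refine h.resolve_left (div_ne_zero (neg_ne_zero.mpr (pow_ne_zero _ ?_)) ?_)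
  · simp [Real.pi_ne_zero]
  · exact_mod_cast m.factorial_ne_zero

open Finset in
lemma sum_LFunction_mul_conj {m n N : ℕ} [NeZero N] (hm : 1 ≤ m) (hn : 1 ≤ n)
    (hpar : m % 2 = n % 2) (hmn : ¬(m = 1 ∧ n = 1)) :
    4 * ∑ χ : DirichletCharacter ℂ N with χ (-1) = (-1) ^ m,
        χ.LFunction m * (starRingEnd ℂ) (χ.LFunction n) =
      (2 * π * Complex.I) ^ m / m.factorial * ((-(2 * π * Complex.I)) ^ n / n.factorial) *
        (N.totient * ∑ a ∈ range N with a.Coprime N,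
          bernoulliDFT N m a * (starRingEnd ℂ) (bernoulliDFT N n a)) := by
  have hpow : (-1 : ℂ) ^ m = (-1) ^ n := by
    rw [neg_one_pow_eq_pow_mod_two (n := m), hpar, ← neg_one_pow_eq_pow_mod_two]
  have hc : (starRingEnd ℂ) (-(2 * π * Complex.I) ^ n / n.factorial) =
      -(-(2 * π * Complex.I)) ^ n / n.factorial := by
    simp [Complex.conj_ofNat]
  rw [← ZMod.sum_isUnit_val fun a => bernoulliDFT N m a * (starRingEnd ℂ) (bernoulliDFT N n a),
    ← sum_dirichletCharacter_sum_mul_conj (fun a => bernoulliDFT N m a.val)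
      (fun a => bernoulliDFT N n a.val), sum_filter, mul_sum, mul_sum]
  refine sum_congr rfl fun χ _ => ?_
  split_ifs with hχ
  · have h1 := sum_apply_mul_bernoulliDFT hm hχ
    have h2 := congrArg (starRingEnd ℂ) (sum_apply_mul_bernoulliDFT hn (hχ.trans hpow))
    rw [map_mul, hc, map_mul, ← hpow] at h2
    have hsq : ((-1 : ℂ) ^ m) * (-1) ^ m = 1 := by rw [← mul_pow]; simp
    have h3 := congrArg₂ (· * ·) h1 h2
    simp only [map_mul, map_pow, map_neg, map_one, map_ofNat] at h3
    linear_combination -h3 - 4 * χ.LFunction m * (starRingEnd ℂ) (χ.LFunction n) * hsq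
  · rcases (by omega : 2 ≤ m ∨ 2 ≤ n) with h | h
    · rw [sum_apply_mul_bernoulliDFT_eq_zero h hχ]
      simp
    · rw [sum_apply_mul_bernoulliDFT_eq_zero h (hpow ▸ hχ)]
      simp

lemma pow_mul_neg_pow_div_factorial_eq {m n : ℕ} (hm : 1 ≤ m) (hpar : m % 2 = n % 2) :
    (bernoulli (m + n) : ℂ) ≠ 0 ∧
    (2 * π * Complex.I) ^ m / m.factorial * ((-(2 * π * Complex.I)) ^ n / n.factorial) =
      2 * (riemannZeta (m + n) * (-1) ^ (m + 1) * (m + n).choose m / bernoulli (m + n)) := by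
  obtain ⟨K, hK⟩ : ∃ K, m + n = 2 * K := ⟨(m + n) / 2, by omega⟩
  have hK0 : K ≠ 0 := by omega
  have hζ := riemannZeta_two_mul_nat hK0
  have hζ0 : riemannZeta (2 * K) ≠ 0 := riemannZeta_ne_zero_of_one_le_re (by
    simp only [Complex.mul_re, Complex.re_ofNat, Complex.natCast_re, Complex.im_ofNat,
      Complex.natCast_im, mul_zero, sub_zero]
    exact_mod_cast (by omega : 1 ≤ 2 * K))
  have hB : (bernoulli (2 * K) : ℂ) ≠ 0 := by
    intro h
    rw [h] at hζ
    simp [hζ] at hζ0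
  have hcast : (m + n : ℂ) = 2 * K := by exact_mod_cast hK
  have hneg : (-1 : ℂ) ^ n = (-1) ^ m := by
    rw [neg_one_pow_eq_pow_mod_two (n := n), ← hpar, ← neg_one_pow_eq_pow_mod_two]
  have hfac (j : ℕ) : (j.factorial : ℂ) ≠ 0 := Nat.cast_ne_zero.mpr j.factorial_ne_zero
  have hchoose : ((m + n).choose m : ℂ) = (2 * K).factorial / (m.factorial * n.factorial) := by
    rw [Nat.cast_add_choose, hK]
  have hI : (2 * π * Complex.I) ^ m * (-(2 * π * Complex.I)) ^ n =
      (-1) ^ m * (-1) ^ K * (2 * (2 : ℂ) ^ (2 * K - 1)) * π ^ (2 * K) := by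
    rw [neg_pow, hneg, mul_left_comm, ← pow_add, hK, mul_pow, mul_pow, pow_mul Complex.I,
      Complex.I_sq, ← pow_succ', Nat.sub_add_cancel (by omega)]
    ring
  have hsq : ((-1 : ℂ) ^ K) * (-1) ^ K = 1 := by rw [← mul_pow]; simp
  refine ⟨hK ▸ hB, ?_⟩
  rw [div_mul_div_comm, hI, hcast, hK, hζ, ← hK, hchoose, hK]
  have := hfac m
  have := hfac n
  have := hfac (2 * K)
  field_simp
  ring

open Finset in
lemma sum_range_mul_prod_primeFactors {f : ℕ} (hf : 1 < f) (j : ℕ) (c : ℕ → ℂ) :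
    ∑ k ∈ range (j + 1), c k * (∏ p ∈ f.primeFactors, (1 - 1 / (p : ℂ) ^ (2 * k))) =
      ∑ k ∈ Icc 1 j, c k * (∏ p ∈ f.primeFactors, (1 - 1 / (p : ℂ) ^ (2 * k))) := by
  have h0 : ∏ p ∈ f.primeFactors, (1 - 1 / (p : ℂ) ^ (2 * 0)) = 0 := by
    obtain ⟨p, hp⟩ := Nat.nonempty_primeFactors.mpr hf
    exact prod_eq_zero hp (by simp)
  rw [range_eq_Ico, sum_eq_sum_Ico_succ_bot (by omega), zero_add, h0, mul_zero, zero_add]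
  rfl

/-- **Explicit mean value of `L(m,χ) conj(L(n,χ))`:** for `m, n ≥ 1` of the same
parity with `(m,n) ≠ (1,1)` and `f > 2`,
`(2/φ(f)) ∑_{χ(-1)=(-1)^m} L(m,χ) conj(L(n,χ))` equals
`ζ(m+n)(φ_{m+n}(f)
  + (-1)^{m-1} C(m+n,m) ∑_{k=1}^{⌊m/2⌋} (n/(m+n-2k)) C(m,2k)
      (B_{2k}B_{m+n-2k}/B_{m+n}) φ_{2k}(f)/f^{m+n-2k}
  + (-1)^{n-1} C(m+n,n) ∑_{k=1}^{⌊n/2⌋} (m/(m+n-2k)) C(n,2k)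
      (B_{2k}B_{m+n-2k}/B_{m+n}) φ_{2k}(f)/f^{m+n-2k})`. -/
theorem mean_value_L_m_L_n (m n f : ℕ) (hm : 1 ≤ m) (hn : 1 ≤ n)
    (hpar : m % 2 = n % 2) (hmn : ¬(m = 1 ∧ n = 1)) [NeZero f] (hf : 2 < f) :
    (2 / (Nat.totient f : ℂ)) *
      ∑ χ ∈ Finset.univ.filter
          (fun χ : DirichletCharacter ℂ f => χ (-1) = (-1) ^ m),
        χ.LFunction m * (starRingEnd ℂ) (χ.LFunction n)
    = riemannZeta (m + n) *
        ((∏ p ∈ f.primeFactors, (1 - 1 / (p : ℂ) ^ (m + n)))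
          + (-1) ^ (m - 1) * (Nat.choose (m + n) m : ℂ) *
            (∑ k ∈ Finset.Icc 1 (m / 2),
              ((n : ℂ) / ((m + n - 2 * k : ℕ) : ℂ)) * (Nat.choose m (2 * k) : ℂ) *
                ((bernoulli (2 * k) : ℂ) * (bernoulli (m + n - 2 * k) : ℂ) /
                  (bernoulli (m + n) : ℂ)) *
                (∏ p ∈ f.primeFactors, (1 - 1 / (p : ℂ) ^ (2 * k))) /
                  (f : ℂ) ^ (m + n - 2 * k))
          + (-1) ^ (n - 1) * (Nat.choose (m + n) n : ℂ) *
            (∑ k ∈ Finset.Icc 1 (n / 2),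
              ((m : ℂ) / ((m + n - 2 * k : ℕ) : ℂ)) * (Nat.choose n (2 * k) : ℂ) *
                ((bernoulli (2 * k) : ℂ) * (bernoulli (m + n - 2 * k) : ℂ) /
                  (bernoulli (m + n) : ℂ)) *
                (∏ p ∈ f.primeFactors, (1 - 1 / (p : ℂ) ^ (2 * k))) /
                  (f : ℂ) ^ (m + n - 2 * k))) := by
  obtain ⟨hB, hQ⟩ := pow_mul_neg_pow_div_factorial_eq hm hpar
  have hS := sum_LFunction_mul_conj (N := f) hm hn hpar hmn
  have hφ : (f.totient : ℂ) ≠ 0 :=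
    Nat.cast_ne_zero.mpr (Nat.totient_pos.mpr (by omega)).ne'
  have hneg : (-1 : ℂ) ^ n = (-1) ^ m := by
    rw [neg_one_pow_eq_pow_mod_two (n := n), ← hpar, ← neg_one_pow_eq_pow_mod_two]
  have hpred {j : ℕ} (hj : 1 ≤ j) : (-1 : ℂ) ^ (j - 1) = -(-1) ^ j := by
    obtain ⟨i, rfl⟩ := Nat.exists_eq_add_of_le' hj
    rw [Nat.add_sub_cancel, pow_succ]
    ring
  have hsum (a b : ℕ) : ∑ k ∈ Finset.range (a / 2 + 1),
      (a.choose (2 * k) : ℂ) * (bernoulli (2 * k) : ℂ) *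
        (b / ((m + n - 2 * k : ℕ) : ℂ) * bernoulli (m + n - 2 * k)) *
        (∏ p ∈ f.primeFactors, (1 - 1 / (p : ℂ) ^ (2 * k))) / (f : ℂ) ^ (m + n - 2 * k) =
      bernoulli (m + n) * ∑ k ∈ Finset.Icc 1 (a / 2),
        ((b : ℂ) / ((m + n - 2 * k : ℕ) : ℂ)) * (Nat.choose a (2 * k) : ℂ) *
          ((bernoulli (2 * k) : ℂ) * (bernoulli (m + n - 2 * k) : ℂ) / (bernoulli (m + n) : ℂ)) *
          (∏ p ∈ f.primeFactors, (1 - 1 / (p : ℂ) ^ (2 * k))) / (f : ℂ) ^ (m + n - 2 * k) := by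
    rw [Finset.mul_sum]
    simp only [mul_div_right_comm _ (∏ p ∈ f.primeFactors, _)]
    rw [sum_range_mul_prod_primeFactors (by omega)]
    refine Finset.sum_congr rfl fun k _ => ?_
    field_simp
  rw [hQ, sum_coprime_bernoulliDFT_mul_conj hm hn (by omega), hsum, hsum] at hS
  have hfac : ((m.factorial * n.factorial / (m + n).factorial : ℂ)) * (m + n).choose m = 1 := by
    rw [Nat.cast_add_choose]
    have hfac' (j : ℕ) : (j.factorial : ℂ) ≠ 0 := Nat.cast_ne_zero.mpr j.factorial_ne_zero
    have := hfac' m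
    have := hfac' n
    have := hfac' (m + n)
    field_simp
  have hsq : ((-1 : ℂ) ^ m) * (-1) ^ m = 1 := by rw [← mul_pow]; simp
  have hch : (m + n).choose n = (m + n).choose m := Nat.choose_symm_add.symm
  rw [hpred hm, hpred hn, hneg, hch]
  rw [pow_succ] at hS
  generalize (∑ χ : DirichletCharacter ℂ f with χ (-1) = (-1) ^ m, _ : ℂ) = S at hS ⊢
  generalize (∑ k ∈ Finset.Icc 1 (m / 2), _ : ℂ) = S₁ at hS ⊢
  generalize (∑ k ∈ Finset.Icc 1 (n / 2), _ : ℂ) = S₂ at hS ⊢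
  generalize (∏ p ∈ f.primeFactors, _ : ℂ) = P at hS ⊢
  generalize (m.factorial * n.factorial / (m + n).factorial : ℂ) = F at hS hfac
  generalize ((m + n).choose m : ℂ) = C at hS hfac ⊢
  generalize riemannZeta (m + n) = Z at hS ⊢
  generalize (-1 : ℂ) ^ m = e at hS hsq ⊢
  field_simp at hS ⊢
  linear_combination hS / 2 + Z * P * f.totient * (e ^ 2 * hfac + hsq)
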